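/- Let (X,d,m) be an isotropic PI space. Let E ⊆ X be a set of finite perimeter and let (E_n)_{n∈ℕ} be an increasing sequence of indecomposable sets such that E = ∪_n E_n. Then E is indecomposable. -/

import Mathlib

open MeasureTheory Metric Filter Set
open scoped ENNReal NNReal Topology

namespace PaperBV

noncomputable section

variable {X : Type*} [MetricSpace X]

/-- `f` is locally Lipschitz on `Ω`. -/
def LocLipOn (Ω : Set X) (f : X → ℝ) : Prop :=
  ∀ x ∈ Ω, ∃ K : ℝ≥0, ∃ t ∈ 𝓝[Ω] x, LipschitzOnWith K f t

/-- The local Lipschitz constant (slope) `lip f` of a function, with value `0` at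
points that are not accumulation points (there the filter `𝓝[≠] x` is trivial). -/
def lipConst (f : X → ℝ) (x : X) : ℝ≥0∞ :=
  Filter.limsup (fun y => ENNReal.ofReal (|f y - f x| / dist y x)) (𝓝[≠] x)

variable [MeasurableSpace X]

/-- Convergence `fn → f` in `L¹_loc(μ⌊Ω)`. -/
def TendstoL1loc (μ : Measure X) (Ω : Set X) (fn : ℕ → X → ℝ) (f : X → ℝ) : Prop :=
  ∀ K : Set X, IsCompact K → K ⊆ Ω →
    Filter.Tendsto (fun n => ∫⁻ x in K, ENNReal.ofReal |fn n x - f x| ∂μ)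
      Filter.atTop (𝓝 0)

/-- The total variation `|Df|(Ω)` of `f` on an open set `Ω`, defined by relaxation of the
integral of the local Lipschitz constant along locally Lipschitz approximations. -/
def tvOpen (μ : Measure X) (f : X → ℝ) (Ω : Set X) : ℝ≥0∞ :=
  sInf { a : ℝ≥0∞ | ∃ fn : ℕ → X → ℝ, (∀ n, LocLipOn Ω (fn n)) ∧ TendstoL1loc μ Ω fn f ∧
    a = Filter.liminf (fun n => ∫⁻ x in Ω, lipConst (fn n) x ∂μ) Filter.atTop }

/-- The total variation measure `|Df|(B)` of `f` on an arbitrary set, obtained from the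
values on open sets by the Carathéodory construction. -/
def tv (μ : Measure X) (f : X → ℝ) (B : Set X) : ℝ≥0∞ :=
  ⨅ (Ω : Set X) (_ : IsOpen Ω) (_ : B ⊆ Ω), tvOpen μ f Ω

/-- `f` is a function of bounded variation: `f ∈ L¹(μ)` and `|Df|(X) < ∞`. -/
def BVFun (μ : Measure X) (f : X → ℝ) : Prop :=
  MeasureTheory.Integrable f μ ∧ tv μ f Set.univ < ⊤

/-- The perimeter `P(E, B) = |D 1_E|(B)`. -/
def perim (μ : Measure X) (E B : Set X) : ℝ≥0∞ :=
  tv μ (E.indicator fun _ => (1 : ℝ)) B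

/-- `E` is a (Borel) set of finite perimeter. -/
def FinPerim (μ : Measure X) (E : Set X) : Prop :=
  MeasurableSet E ∧ perim μ E Set.univ < ⊤

/-- `μ` is a doubling measure with doubling constant `CD`. -/
def Doubling (μ : Measure X) (CD : ℝ≥0) : Prop :=
  1 ≤ CD ∧ ∀ (x : X) (r : ℝ), 0 < r → μ (ball x (2 * r)) ≤ (CD : ℝ≥0∞) * μ (ball x r)

/-- The mean value `f_{x,r}` of `f` on the ball `B_r(x)`. -/
def ballAvg (μ : Measure X) (f : X → ℝ) (x : X) (r : ℝ) : ℝ :=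
  (∫ y in ball x r, f y ∂μ) / (μ (ball x r)).toReal

/-- The weak `(1,1)`-Poincaré inequality with constants `CP`, `lam`,
for locally Lipschitz functions. -/
def WeakPoincare (μ : Measure X) (CP lam : ℝ) : Prop :=
  ∀ f : X → ℝ, LocLipOn Set.univ f → ∀ (x : X) (r : ℝ), 0 < r →
    ∫⁻ y in ball x r, ENNReal.ofReal |f y - ballAvg μ f x r| ∂μ ≤
      ENNReal.ofReal (CP * r) * ∫⁻ y in ball x (lam * r), lipConst f y ∂μ

/-- A PI space: doubling and supporting a weak `(1,1)`-Poincaré inequality. -/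
def IsPI (μ : Measure X) : Prop :=
  ∃ (CD : ℝ≥0) (CP lam : ℝ), Doubling μ CD ∧ 0 < CP ∧ 1 ≤ lam ∧ WeakPoincare μ CP lam

/-- The pre-measure `H_δ` of the codimension-one Hausdorff measure: infimum over countable
covers by balls of radii at most `δ` of `∑ μ(B_{r_i}(x_i)) / (2 r_i)`. -/
def preH (μ : Measure X) (δ : ℝ) (S : Set X) : ℝ≥0∞ :=
  ⨅ (c : ℕ → X × ℝ) (_ : ∀ i, 0 < (c i).2 ∧ (c i).2 ≤ δ)
    (_ : S ⊆ ⋃ i, ball (c i).1 (c i).2),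
    ∑' i, μ (ball (c i).1 (c i).2) / ENNReal.ofReal (2 * (c i).2)

/-- The codimension-one Hausdorff measure `H = lim_{δ ↓ 0} H_δ = sup_{δ > 0} H_δ`
(as an outer-measure-type set function). -/
def codimH (μ : Measure X) (S : Set X) : ℝ≥0∞ :=
  ⨆ (δ : ℝ) (_ : 0 < δ), preH μ δ S

/-- The upper density of `E` at `x`. -/
def upperDens (μ : Measure X) (E : Set X) (x : X) : ℝ≥0∞ :=
  Filter.limsup (fun r : ℝ => μ (E ∩ ball x r) / μ (ball x r)) (𝓝[>] (0 : ℝ))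

/-- The essential boundary `∂^e E`. -/
def essBdry (μ : Measure X) (E : Set X) : Set X :=
  {x | 0 < upperDens μ E x ∧ 0 < upperDens μ Eᶜ x}

/-- The essential interior `E^1`: points of density `1`. -/
def essInt (μ : Measure X) (E : Set X) : Set X :=
  {x | Filter.Tendsto (fun r : ℝ => μ (E ∩ ball x r) / μ (ball x r))
    (𝓝[>] (0 : ℝ)) (𝓝 (1 : ℝ≥0∞))}

/-- Integral `∫_S f dν` with respect to an outer-measure-type set function `ν`,
via the layer-cake formula. -/
def outerLint (ν : Set X → ℝ≥0∞) (S : Set X) (f : X → ℝ≥0∞) : ℝ≥0∞ :=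
  ∫⁻ t in Set.Ioi (0 : ℝ), ν {x ∈ S | ENNReal.ofReal t < f x}

/-- `θ` is a family of densities representing the perimeter measures with respect to the
codimension-one Hausdorff measure: `P(E,B) = ∫_{B ∩ ∂^e E} θ_E dH`, with
`γ ≤ θ_E ≤ C` on `∂^e E` for structural constants `0 < γ`, `C < ∞`. -/
def PerimRepr (μ : Measure X) (θ : Set X → X → ℝ≥0∞) : Prop :=
  ∃ γ C : ℝ≥0∞, 0 < γ ∧ C ≠ ⊤ ∧
    ∀ E : Set X, FinPerim μ E →
      (∀ x ∈ essBdry μ E, γ ≤ θ E x ∧ θ E x ≤ C) ∧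
      ∀ B : Set X, MeasurableSet B →
        perim μ E B = outerLint (codimH μ) (B ∩ essBdry μ E) (θ E)

/-- The space is isotropic: the densities `θ_E` can be chosen so that, whenever `F ⊆ E` are
sets of finite perimeter, `θ_F = θ_E` holds `H`-a.e. on `∂^e F ∩ ∂^e E`. -/
def Isotropic (μ : Measure X) : Prop :=
  ∃ θ : Set X → X → ℝ≥0∞, PerimRepr μ θ ∧
    ∀ E F : Set X, FinPerim μ E → FinPerim μ F → F ⊆ E →
      codimH μ {x ∈ essBdry μ F ∩ essBdry μ E | θ F x ≠ θ E x} = 0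

/-- Property (1.2): `H(∂^e E ∩ ∂^e F ∩ ∂^e (E ∪ F)) = 0` for disjoint sets of finite
perimeter. -/
def Prop12 (μ : Measure X) : Prop :=
  ∀ E F : Set X, FinPerim μ E → FinPerim μ F → Disjoint E F →
    codimH μ (essBdry μ E ∩ essBdry μ F ∩ essBdry μ (E ∪ F)) = 0

/-- `E` is decomposable in `B`: `E ∩ B` admits a partition into two sets of finite perimeter
and positive measure such that the perimeter in `B` is additive. -/
def DecomposableIn (μ : Measure X) (E B : Set X) : Prop :=
  ∃ F G : Set X, FinPerim μ F ∧ FinPerim μ G ∧ Disjoint F G ∧ F ∪ G = E ∩ B ∧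
    0 < μ F ∧ 0 < μ G ∧ perim μ E B = perim μ F B + perim μ G B

/-- `E` is a set of finite perimeter which is indecomposable in `B`. -/
def IndecomposableIn (μ : Measure X) (E B : Set X) : Prop :=
  FinPerim μ E ∧ ¬ DecomposableIn μ E B

/-- `E` is an indecomposable set (of finite perimeter). -/
def Indecomposable (μ : Measure X) (E : Set X) : Prop :=
  IndecomposableIn μ E Set.univ

/-- `E` is a simple set. -/
def SimpleSet (μ : Measure X) (E : Set X) : Prop :=
  FinPerim μ E ∧ μ E < ⊤ ∧
  ∀ F : Set X, FinPerim μ F → codimH μ (essBdry μ F \ essBdry μ E) = 0 →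
    μ F = 0 ∨ μ Fᶜ = 0 ∨ μ (symmDiff F E) = 0 ∨ μ (symmDiff F Eᶜ) = 0

end

section CodimensionOneMeasure

variable {X : Type*} [MetricSpace X] [MeasurableSpace X] {μ : Measure X}

theorem preH_le_tsum {δ : ℝ} {S : Set X} (c : ℕ → X × ℝ)
    (hc : ∀ i, 0 < (c i).2 ∧ (c i).2 ≤ δ) (hS : S ⊆ ⋃ i, ball (c i).1 (c i).2) :
    preH μ δ S ≤ ∑' i, μ (ball (c i).1 (c i).2) / ENNReal.ofReal (2 * (c i).2) :=
  iInf_le_of_le c (iInf_le_of_le hc (iInf_le_of_le hS le_rfl))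

theorem exists_cover_of_preH_lt {δ : ℝ} {S : Set X} {a : ℝ≥0∞} (h : preH μ δ S < a) :
    ∃ c : ℕ → X × ℝ, (∀ i, 0 < (c i).2 ∧ (c i).2 ≤ δ) ∧ S ⊆ ⋃ i, ball (c i).1 (c i).2 ∧
      ∑' i, μ (ball (c i).1 (c i).2) / ENNReal.ofReal (2 * (c i).2) < a := by
  simp only [preH, iInf_lt_iff] at h
  obtain ⟨c, hc, hS, h⟩ := h
  exact ⟨c, hc, hS, h⟩

theorem preH_mono {δ : ℝ} {S T : Set X} (h : S ⊆ T) : preH μ δ S ≤ preH μ δ T :=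
  le_iInf fun c => le_iInf fun hc => le_iInf fun hT => preH_le_tsum c hc (h.trans hT)

theorem preH_anti {δ δ' : ℝ} (h : δ ≤ δ') (S : Set X) : preH μ δ' S ≤ preH μ δ S :=
  le_iInf fun c => le_iInf fun hc => le_iInf fun hS =>
    preH_le_tsum c (fun i => ⟨(hc i).1, (hc i).2.trans h⟩) hS

theorem preH_iUnion_le (δ : ℝ) (S : ℕ → Set X) :
    preH μ δ (⋃ n, S n) ≤ ∑' n, preH μ δ (S n) := by
  refine ENNReal.le_of_forall_pos_le_add fun ε hε hfin => ?_
  obtain ⟨ε', hε', hsum⟩ := ENNReal.exists_pos_sum_of_countable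
    (ENNReal.coe_ne_zero.2 hε.ne') ℕ
  have hlt : ∀ n, preH μ δ (S n) < preH μ δ (S n) + ε' n := fun n =>
    ENNReal.lt_add_right ((ENNReal.le_tsum n).trans_lt hfin).ne
      (ENNReal.coe_ne_zero.2 (hε' n).ne')
  choose c hc hS hlt using fun n => exists_cover_of_preH_lt (hlt n)
  let e := Nat.pairEquiv.symm
  calc preH μ δ (⋃ n, S n)
      ≤ ∑' i, μ (ball (c (e i).1 (e i).2).1 (c (e i).1 (e i).2).2) /
          ENNReal.ofReal (2 * (c (e i).1 (e i).2).2) := by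
        refine preH_le_tsum (fun i => c (e i).1 (e i).2) (fun i => hc _ _) ?_
        refine iUnion_subset fun n x hx => ?_
        obtain ⟨i, hi⟩ := mem_iUnion.1 (hS n hx)
        exact mem_iUnion.2 ⟨e.symm (n, i), by simpa using hi⟩
    _ = ∑' p : ℕ × ℕ, μ (ball (c p.1 p.2).1 (c p.1 p.2).2) /
          ENNReal.ofReal (2 * (c p.1 p.2).2) :=
        e.tsum_eq fun p : ℕ × ℕ => μ (ball (c p.1 p.2).1 (c p.1 p.2).2) /
          ENNReal.ofReal (2 * (c p.1 p.2).2)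
    _ = ∑' n, ∑' i, μ (ball (c n i).1 (c n i).2) / ENNReal.ofReal (2 * (c n i).2) :=
        ENNReal.tsum_prod (f := fun n i => μ (ball (c n i).1 (c n i).2) /
          ENNReal.ofReal (2 * (c n i).2))
    _ ≤ ∑' n, (preH μ δ (S n) + ε' n) := ENNReal.tsum_le_tsum fun n => (hlt n).le
    _ = ∑' n, preH μ δ (S n) + ∑' n, (ε' n : ℝ≥0∞) := ENNReal.tsum_add
    _ ≤ ∑' n, preH μ δ (S n) + ε := by gcongr

theorem preH_empty (h : codimH μ ∅ = 0) {δ : ℝ} (hδ : 0 < δ) : preH μ δ ∅ = 0 := by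
  simp only [codimH, ENNReal.iSup_eq_zero] at h
  exact h δ hδ

/-- Since covers are indexed by all of `ℕ`, the single-ball bound needs covers of `∅` of
arbitrarily small cost. -/
theorem preH_ball_le (h : codimH μ ∅ = 0) {δ r : ℝ} (hr : 0 < r) (hrδ : r ≤ δ) (x : X) :
    preH μ δ (ball x r) ≤ μ (ball x r) / ENNReal.ofReal (2 * r) := by
  refine ENNReal.le_of_forall_pos_le_add fun ε hε _ => ?_
  obtain ⟨c, hc, -, hlt⟩ := exists_cover_of_preH_lt (μ := μ) (δ := δ) (S := ∅) (a := ε)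
    (by rw [preH_empty h (hr.trans_le hrδ)]; exact_mod_cast hε)
  let d : ℕ → X × ℝ := fun n => Nat.casesOn n (x, r) c
  calc preH μ δ (ball x r)
      ≤ ∑' i, μ (ball (d i).1 (d i).2) / ENNReal.ofReal (2 * (d i).2) := by
        refine preH_le_tsum d (fun i => ?_) (subset_iUnion_of_subset 0 subset_rfl)
        cases i with
        | zero => exact ⟨hr, hrδ⟩
        | succ i => exact hc i
    _ = μ (ball x r) / ENNReal.ofReal (2 * r) +
          ∑' i, μ (ball (c i).1 (c i).2) / ENNReal.ofReal (2 * (c i).2) :=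
        tsum_eq_zero_add' ENNReal.summable
    _ ≤ μ (ball x r) / ENNReal.ofReal (2 * r) + ε := by gcongr

/-- `preH μ δ` as an outer measure. -/
noncomputable def preHOuter (h : codimH μ ∅ = 0) (δ : {δ : ℝ // 0 < δ}) : OuterMeasure X where
  measureOf := preH μ δ
  empty := preH_empty h δ.2
  mono := preH_mono
  iUnion_nat S _ := preH_iUnion_le δ S

/-- `codimH μ` as an outer measure. -/
noncomputable def codimHOuter (h : codimH μ ∅ = 0) : OuterMeasure X := ⨆ δ, preHOuter h δ

theorem codimHOuter_apply (h : codimH μ ∅ = 0) (S : Set X) :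
    codimHOuter h S = codimH μ S := by
  rw [codimHOuter, OuterMeasure.iSup_apply, codimH, iSup_subtype']
  rfl

theorem preH_add_le_of_separated (h : codimH μ ∅ = 0) {S T : Set X} {r δ : ℝ} (hδ : 0 < δ)
    (hr : 2 * δ ≤ r) (hST : ∀ x ∈ S, ∀ y ∈ T, r ≤ dist x y) :
    preH μ δ S + preH μ δ T ≤ preH μ δ (S ∪ T) := by
  refine le_iInf fun c => le_iInf fun hc => le_iInf fun hcov => ?_
  set cost : ℕ → ℝ≥0∞ := fun i => μ (ball (c i).1 (c i).2) / ENNReal.ofReal (2 * (c i).2)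
  have key : ∀ U ⊆ S ∪ T, preH μ δ U ≤
      ∑' i, {i | (ball (c i).1 (c i).2 ∩ U).Nonempty}.indicator cost i := by
    intro U hU
    calc preH μ δ U ≤ preH μ δ (⋃ i, ball (c i).1 (c i).2 ∩ U) := by
          refine preH_mono fun x hx => ?_
          obtain ⟨i, hi⟩ := mem_iUnion.1 (hcov (hU hx))
          exact mem_iUnion.2 ⟨i, hi, hx⟩
      _ ≤ ∑' i, preH μ δ (ball (c i).1 (c i).2 ∩ U) := preH_iUnion_le _ _
      _ ≤ _ := by
          refine ENNReal.tsum_le_tsum fun i => ?_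
          by_cases hi : (ball (c i).1 (c i).2 ∩ U).Nonempty
          · rw [indicator_of_mem (by exact hi)]
            exact (preH_mono inter_subset_left).trans (preH_ball_le h (hc i).1 (hc i).2 _)
          · rw [not_nonempty_iff_eq_empty.1 hi, preH_empty h hδ]
            exact zero_le
  refine (add_le_add (key S subset_union_left) (key T subset_union_right)).trans ?_
  rw [← ENNReal.tsum_add]
  refine ENNReal.tsum_le_tsum fun i => ?_
  by_cases hi : (ball (c i).1 (c i).2 ∩ S).Nonempty
  · have hi' : ¬ (ball (c i).1 (c i).2 ∩ T).Nonempty := by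
      rintro ⟨y, hy, hyT⟩
      obtain ⟨x, hx, hxS⟩ := hi
      have h1 := hST x hxS y hyT
      have h2 := dist_triangle_right x y (c i).1
      rw [mem_ball] at hx hy
      linarith [(hc i).2]
    have hT : {i | (ball (c i).1 (c i).2 ∩ T).Nonempty}.indicator cost i = 0 :=
      indicator_of_notMem (by exact hi') _
    rw [hT, add_zero]
    exact indicator_le_self _ _ _
  · have hS : {i | (ball (c i).1 (c i).2 ∩ S).Nonempty}.indicator cost i = 0 :=
      indicator_of_notMem (by exact hi) _
    rw [hS, zero_add]
    exact indicator_le_self _ _ _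

theorem isMetric_codimHOuter (h : codimH μ ∅ = 0) : (codimHOuter h).IsMetric := by
  rintro S T ⟨r, hr0, hST⟩
  refine le_antisymm (measure_union_le _ _) ?_
  obtain ⟨q, hq0, hqr⟩ : ∃ q : ℝ≥0, 0 < q ∧ (q : ℝ≥0∞) < r := by
    obtain ⟨q, hq0, hq⟩ := ENNReal.lt_iff_exists_nnreal_btwn.1 (pos_iff_ne_zero.2 hr0)
    exact ⟨q, by exact_mod_cast hq0, hq⟩
  have hdist : ∀ x ∈ S, ∀ y ∈ T, (q : ℝ) ≤ dist x y := fun x hx y hy => by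
    have h1 : (q : ℝ≥0∞) ≤ edist x y := hqr.le.trans (hST x hx y hy)
    rw [edist_nndist] at h1
    exact_mod_cast h1
  simp only [codimHOuter_apply, codimH]
  have hq : (0 : ℝ) < q := by exact_mod_cast hq0
  refine ENNReal.biSup_add_biSup_le' (p := fun δ : ℝ => 0 < δ) (q := fun δ : ℝ => 0 < δ)
    ⟨1, one_pos⟩ ⟨1, one_pos⟩ fun δ hδ δ' hδ' => ?_
  have hmin : 0 < min (min δ δ') (q / 2) := lt_min (lt_min hδ hδ') (by positivity)
  calc preH μ δ S + preH μ δ' T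
      ≤ preH μ (min (min δ δ') (q / 2)) S + preH μ (min (min δ δ') (q / 2)) T :=
        add_le_add (preH_anti ((min_le_left _ _).trans (min_le_left _ _)) _)
          (preH_anti ((min_le_left _ _).trans (min_le_right _ _)) _)
    _ ≤ preH μ (min (min δ δ') (q / 2)) (S ∪ T) :=
        preH_add_le_of_separated h hmin
          (by linarith [min_le_right (min δ δ') ((q : ℝ) / 2)]) hdist
    _ ≤ _ := le_iSup₂_of_le _ hmin le_rfl

theorem codimH_mono (h : codimH μ ∅ = 0) {S T : Set X} (hST : S ⊆ T) :
    codimH μ S ≤ codimH μ T := by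
  rw [← codimHOuter_apply h, ← codimHOuter_apply h]
  exact measure_mono hST

theorem codimH_union_le (h : codimH μ ∅ = 0) (S T : Set X) :
    codimH μ (S ∪ T) ≤ codimH μ S + codimH μ T := by
  simp only [← codimHOuter_apply h]
  exact measure_union_le _ _

theorem codimH_inter_add_diff [BorelSpace X] (h : codimH μ ∅ = 0) {A : Set X}
    (hA : MeasurableSet A) (S : Set X) : codimH μ (S ∩ A) + codimH μ (S \ A) = codimH μ S := by
  simp only [← codimHOuter_apply h]
  rw [BorelSpace.measurable_eq (α := X)] at hA
  exact ((isMetric_codimHOuter h).borel_le_caratheodory A hA S).symm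

theorem codimH_le_of_subset_union_null (h : codimH μ ∅ = 0) {S T N : Set X} (hN : codimH μ N = 0)
    (hS : S ⊆ T ∪ N) : codimH μ S ≤ codimH μ T :=
  (codimH_mono h hS).trans ((codimH_union_le h T N).trans (by rw [hN, add_zero]))

end CodimensionOneMeasure

section FinitePerimeter

theorem limsup_add_le_ennreal {α : Type*} (l : Filter α) (u v : α → ℝ≥0∞) :
    limsup (fun a => u a + v a) l ≤ limsup u l + limsup v l := by
  refine ENNReal.le_of_forall_pos_le_add fun ε hε hfin => ?_
  have hε2 : ((ε / 2 : ℝ≥0) : ℝ≥0∞) ≠ 0 := ENNReal.coe_ne_zero.2 (half_pos hε).ne'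
  have hu := eventually_lt_of_limsup_lt
    (ENNReal.lt_add_right (ne_top_of_le_ne_top hfin.ne le_self_add) hε2 : limsup u l < _)
  have hv := eventually_lt_of_limsup_lt
    (ENNReal.lt_add_right (ne_top_of_le_ne_top hfin.ne le_add_self) hε2 : limsup v l < _)
  refine limsup_le_of_le (by isBoundedDefault) ?_
  filter_upwards [hu, hv] with a h1 h2
  refine (add_le_add h1.le h2.le).trans_eq ?_
  rw [add_add_add_comm, ← ENNReal.coe_add, add_halves]

variable {X : Type*} [MetricSpace X]

theorem LocLipOn.continuous {f : X → ℝ} (hf : LocLipOn univ f) : Continuous f := by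
  refine continuous_iff_continuousAt.2 fun x => ?_
  obtain ⟨K, t, ht, hK⟩ := hf x (mem_univ x)
  rw [nhdsWithin_univ] at ht
  exact hK.continuousOn.continuousAt ht

theorem LocLipOn.min {Ω : Set X} {f g : X → ℝ} (hf : LocLipOn Ω f) (hg : LocLipOn Ω g) :
    LocLipOn Ω fun x => min (f x) (g x) := by
  intro x hx
  obtain ⟨K, s, hs, hK⟩ := hf x hx
  obtain ⟨L, t, ht, hL⟩ := hg x hx
  refine ⟨_, s ∩ t, inter_mem hs ht, lipschitzOnWith_iff_restrict.2
    ((lipschitzOnWith_iff_restrict.1 (hK.mono inter_subset_left)).min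
      (lipschitzOnWith_iff_restrict.1 (hL.mono inter_subset_right)))⟩

theorem lipConst_min_le (f g : X → ℝ) (x : X) :
    lipConst (fun x => min (f x) (g x)) x ≤ lipConst f x + lipConst g x := by
  refine le_trans (limsup_le_limsup (Eventually.of_forall fun y => ?_))
    (limsup_add_le_ennreal _ _ _)
  rw [← ENNReal.ofReal_add (by positivity) (by positivity), ← add_div]
  refine ENNReal.ofReal_le_ofReal (div_le_div_of_nonneg_right ?_ dist_nonneg)
  exact (abs_min_sub_min_le_max _ _ _ _).trans
    (max_le_add_of_nonneg (abs_nonneg _) (abs_nonneg _))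

theorem lipConst_const (c : ℝ) (x : X) : lipConst (fun _ => c) x = 0 := by
  simp only [lipConst, sub_self, abs_zero, zero_div, ENNReal.ofReal_zero]
  exact limsup_const_bot

variable [MeasurableSpace X] {μ : Measure X}

theorem measurable_lipConst [BorelSpace X] {f : X → ℝ} (hf : Continuous f) :
    Measurable (lipConst f) := by
  have heq : lipConst f = fun x => ⨅ n : ℕ,
      ⨆ y ∈ ball x (1 / ((n : ℝ) + 1)) ∩ {x}ᶜ, ENNReal.ofReal (|f y - f x| / dist y x) := by
    ext x
    rw [lipConst, (nhdsWithin_hasBasis nhds_basis_ball_inv_nat_succ _).limsup_eq_iInf_iSup]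
    simp only [iInf_true]
  rw [heq]
  refine Measurable.iInf fun n => LowerSemicontinuous.measurable fun x a ha => ?_
  simp only [lt_iSup_iff] at ha
  obtain ⟨y, ⟨hy, hyx⟩, ha⟩ := ha
  have hyx' : y ≠ x := hyx
  have hcont : ContinuousAt (fun z => ENNReal.ofReal (|f y - f z| / dist y z)) x := by
    refine ENNReal.continuous_ofReal.continuousAt.comp
      (ContinuousAt.div ?_ ?_ (dist_ne_zero.2 hyx'))
    · exact (continuous_const.sub hf).abs.continuousAt
    · exact (continuous_const.dist continuous_id).continuousAt
  filter_upwards [hcont.eventually (lt_mem_nhds ha), isOpen_ne.mem_nhds hyx'.symm,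
    isOpen_ball.mem_nhds (mem_ball_comm.1 hy)] with z h1 h2 h3
  exact h1.trans_le (le_iSup₂ (f := fun y _ => ENNReal.ofReal (|f y - f z| / dist y z)) y
    ⟨mem_ball_comm.1 h3, fun h => h2 h.symm⟩)

theorem exists_approx_of_finPerim {E : Set X} (hE : FinPerim μ E) :
    ∃ a : ℝ≥0∞, a ≠ ⊤ ∧ ∃ fn : ℕ → X → ℝ, (∀ n, LocLipOn univ (fn n)) ∧
      TendstoL1loc μ univ fn (E.indicator fun _ => 1) ∧
      ∀ n, ∫⁻ x, lipConst (fn n) x ∂μ ≤ a := by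
  obtain ⟨Ω, h⟩ := iInf_lt_iff.1 hE.2
  obtain ⟨-, h⟩ := iInf_lt_iff.1 h
  obtain ⟨hΩ, h⟩ := iInf_lt_iff.1 h
  obtain rfl := univ_subset_iff.1 hΩ
  obtain ⟨_, ⟨fn, hlip, hconv, rfl⟩, h⟩ := sInf_lt_iff.1 h
  obtain ⟨a, ha, ha'⟩ := exists_between h
  obtain ⟨φ, hφ, hφa⟩ := extraction_of_frequently_atTop 
    (frequently_lt_of_liminf_lt (by isBoundedDefault) ha)
  refine ⟨a, ha'.ne, fn ∘ φ, fun n => hlip _,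
    fun K hK hKΩ => (hconv K hK hKΩ).comp hφ.tendsto_atTop, fun n => ?_⟩
  simpa using (hφa n).le

theorem FinPerim.inter [BorelSpace X] {E F : Set X} (hE : FinPerim μ E) (hF : FinPerim μ F) :
    FinPerim μ (E ∩ F) := by
  refine ⟨hE.1.inter hF.1, ?_⟩
  obtain ⟨a, ha, f, hf, hfE, hfa⟩ := exists_approx_of_finPerim hE
  obtain ⟨b, hb, g, hg, hgF, hgb⟩ := exists_approx_of_finPerim hF
  have hle : liminf (fun n => ∫⁻ x in univ, lipConst (fun x => min (f n x) (g n x)) x ∂μ) atTop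
      ≤ a + b := by
    refine liminf_le_of_le (by isBoundedDefault) fun c hc => ?_
    obtain ⟨n, hn⟩ := hc.exists
    refine hn.trans ?_
    rw [Measure.restrict_univ]
    refine (lintegral_mono (lipConst_min_le (f n) (g n))).trans ?_
    rw [lintegral_add_left (measurable_lipConst (hf n).continuous)]
    exact add_le_add (hfa n) (hgb n)
  refine lt_of_le_of_lt (iInf_le_of_le univ (iInf_le_of_le isOpen_univ
    (iInf_le_of_le subset_rfl (sInf_le ⟨fun n x => min (f n x) (g n x),
      fun n => (hf n).min (hg n), fun K hK hKΩ => ?_, rfl⟩))))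
    (hle.trans_lt (ENNReal.add_lt_top.2 ⟨ha.lt_top, hb.lt_top⟩))
  have hsum := (hfE K hK hKΩ).add (hgF K hK hKΩ)
  rw [add_zero] at hsum
  refine tendsto_of_tendsto_of_tendsto_of_le_of_le tendsto_const_nhds hsum
    (fun n => zero_le) fun n => ?_
  have hmeas : Measurable fun x => ENNReal.ofReal |f n x - E.indicator (fun _ => 1) x| :=
    ((hf n).continuous.measurable.sub (measurable_const.indicator hE.1)).abs.ennreal_ofReal
  rw [← lintegral_add_left hmeas]
  refine lintegral_mono fun x => ?_
  have hind : (E ∩ F).indicator (fun _ => (1 : ℝ)) x =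
      min (E.indicator (fun _ => 1) x) (F.indicator (fun _ => 1) x) := by
    by_cases h1 : x ∈ E <;> by_cases h2 : x ∈ F <;> simp [h1, h2]
  rw [hind, ← ENNReal.ofReal_add (abs_nonneg _) (abs_nonneg _)]
  exact ENNReal.ofReal_le_ofReal ((abs_min_sub_min_le_max _ _ _ _).trans
    (max_le_add_of_nonneg (abs_nonneg _) (abs_nonneg _)))

theorem perim_empty : perim μ (∅ : Set X) univ = 0 := by
  refine le_antisymm (iInf_le_of_le univ (iInf_le_of_le isOpen_univ
    (iInf_le_of_le subset_rfl (sInf_le ⟨fun _ _ => 0, fun _ x _ => ⟨0, univ, univ_mem,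
      (LipschitzWith.const 0).lipschitzOnWith⟩, fun K _ _ => ?_, ?_⟩)))) zero_le
  · simp
  · simp [lipConst_const]

theorem finPerim_empty : FinPerim μ (∅ : Set X) :=
  ⟨MeasurableSet.empty, perim_empty.trans_lt ENNReal.zero_lt_top⟩

theorem PerimRepr.codimH_empty {θ : Set X → X → ℝ≥0∞} (h : PerimRepr μ θ) :
    codimH μ (∅ : Set X) = 0 := by
  obtain ⟨γ, C, -, -, h⟩ := h
  have h0 := (h ∅ finPerim_empty).2 univ MeasurableSet.univ
  rw [perim_empty, outerLint] at h0
  by_contra hne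
  have : ∫⁻ _ in Ioi (0 : ℝ), codimH μ (∅ : Set X) ≤ 0 := by
    refine (lintegral_mono fun t => ?_).trans h0.ge
    exact iSup₂_mono fun δ _ => preH_mono (empty_subset _)
  rw [lintegral_const, Measure.restrict_apply_univ, Real.volume_Ioi, ENNReal.mul_top hne] at this
  exact absurd this (by simp)

end FinitePerimeter

section EssentialBoundary

variable {X : Type*} [MetricSpace X] [MeasurableSpace X] {μ : Measure X}

theorem upperDens_mono {E F : Set X} (h : E ⊆ F) (x : X) : upperDens μ E x ≤ upperDens μ F x :=
  limsup_le_limsup (Eventually.of_forall fun _ =>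
    ENNReal.div_le_div_right (measure_mono (inter_subset_inter_left _ h)) _)

theorem upperDens_union_le (E F : Set X) (x : X) :
    upperDens μ (E ∪ F) x ≤ upperDens μ E x + upperDens μ F x := by
  refine le_trans (limsup_le_limsup (Eventually.of_forall fun r => ?_))
    (limsup_add_le_ennreal _ _ _)
  simp only [← ENNReal.add_div, union_inter_distrib_right]
  exact ENNReal.div_le_div_right (measure_union_le _ _) _

theorem upperDens_union_pos {E F : Set X} {x : X} (h : 0 < upperDens μ (E ∪ F) x) :
    0 < upperDens μ E x ∨ 0 < upperDens μ F x := by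
  simpa only [add_pos_iff] using h.trans_le (upperDens_union_le E F x)

theorem mem_essBdry_of_disjoint {E F : Set X} (hEF : Disjoint E F) {x : X}
    (hE : 0 < upperDens μ E x) (hF : 0 < upperDens μ F x) : x ∈ essBdry μ E :=
  ⟨hE, hF.trans_le (upperDens_mono hEF.subset_compl_left x)⟩

theorem essBdry_union_subset (E F : Set X) : essBdry μ (E ∪ F) ⊆ essBdry μ E ∪ essBdry μ F := by
  rintro x ⟨h, hc⟩
  rcases upperDens_union_pos h with h | h
  · exact Or.inl ⟨h, hc.trans_le (upperDens_mono (compl_subset_compl.2 subset_union_left) x)⟩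
  · exact Or.inr ⟨h, hc.trans_le (upperDens_mono (compl_subset_compl.2 subset_union_right) x)⟩

theorem essBdry_diff_subset {E F : Set X} (hEF : Disjoint E F) :
    essBdry μ E \ essBdry μ F ⊆ essBdry μ (E ∪ F) := by
  rintro x ⟨⟨hE, hEc⟩, hF⟩
  refine ⟨hE.trans_le (upperDens_mono subset_union_left x), ?_⟩
  have hcover : Eᶜ ⊆ (E ∪ F)ᶜ ∪ F := fun y hy => by
    by_cases h : y ∈ F
    · exact Or.inr h
    · exact Or.inl fun hy' => hy'.elim hy h
  rcases upperDens_union_pos (hEc.trans_le (upperDens_mono hcover x)) with h | h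
  · exact h
  · exact absurd (mem_essBdry_of_disjoint hEF.symm h hE) hF

/-- Under doubling, positivity of the upper density can be tested along dyadic radii. -/
theorem upperDens_le_dyadic {CD : ℝ≥0} (hD : Doubling μ CD) (E : Set X) (x : X) :
    upperDens μ E x ≤ CD * limsup (fun n : ℕ => μ (E ∩ ball x ((1 / 2) ^ n)) /
      μ (ball x ((1 / 2) ^ n))) atTop := by
  have hCD : (CD : ℝ≥0∞) ≠ 0 := ENNReal.coe_ne_zero.2 (one_pos.trans_le hD.1).ne'
  refine ENNReal.le_mul_of_forall_lt (Or.inl hCD) (Or.inl ENNReal.coe_ne_top) fun c hc a ha => ?_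
  obtain ⟨N, hN⟩ := eventually_atTop.1 (eventually_lt_of_limsup_lt ha)
  refine limsup_le_of_le (by isBoundedDefault) ?_
  filter_upwards [Ioo_mem_nhdsGT (show (0 : ℝ) < (1 / 2) ^ N by positivity)] with r hr
  obtain ⟨n, hn1, hn2⟩ := exists_nat_pow_near_of_lt_one hr.1
    (hr.2.le.trans (pow_le_one₀ (by norm_num) (by norm_num)))
    (show (0 : ℝ) < 1 / 2 by norm_num) (by norm_num)
  have hNn : N ≤ n := by
    have := (pow_lt_pow_iff_right_of_lt_one₀ (show (0 : ℝ) < 1 / 2 by norm_num)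
      (by norm_num)).1 (hn1.trans hr.2)
    omega
  have hball : μ (ball x ((1 / 2) ^ n)) ≤ CD * μ (ball x r) := by
    refine le_trans (measure_mono (ball_subset_ball ?_)) (hD.2 x r hr.1)
    rw [pow_succ] at hn1
    linarith
  refine le_trans ?_ (mul_le_mul' hc.le (hN n hNn).le)
  have hinv : (μ (ball x r))⁻¹ ≤ CD * (μ (ball x ((1 / 2) ^ n)))⁻¹ := by
    have h := ENNReal.inv_le_inv.2 hball
    rw [ENNReal.mul_inv (Or.inl hCD) (Or.inl ENNReal.coe_ne_top)] at h
    calc (μ (ball x r))⁻¹ = CD * ((CD : ℝ≥0∞)⁻¹ * (μ (ball x r))⁻¹) := by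
          rw [← mul_assoc, ENNReal.mul_inv_cancel hCD ENNReal.coe_ne_top, one_mul]
      _ ≤ _ := by gcongr
  have hnum : μ (E ∩ ball x r) ≤ μ (E ∩ ball x ((1 / 2) ^ n)) :=
    measure_mono (inter_subset_inter_right _ (ball_subset_ball hn2))
  rw [div_eq_mul_inv, div_eq_mul_inv, mul_left_comm]
  exact mul_le_mul' hnum hinv

theorem measurable_measure_inter_ball [BorelSpace X] [SecondCountableTopology X] [SFinite μ]
    {E : Set X} (hE : MeasurableSet E) (r : ℝ) : Measurable fun x => μ (E ∩ ball x r) := by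
  have hs : MeasurableSet {p : X × X | p.2 ∈ E ∧ dist p.2 p.1 < r} :=
    (measurable_snd hE).inter (isOpen_lt (continuous_snd.dist continuous_fst)
      continuous_const).measurableSet
  exact measurable_measure_prodMk_left hs

theorem measurableSet_upperDens_pos [BorelSpace X] [SecondCountableTopology X] [SFinite μ]
    {CD : ℝ≥0} (hD : Doubling μ CD) {E : Set X} (hE : MeasurableSet E) :
    MeasurableSet {x | 0 < upperDens μ E x} := by
  set v : X → ℝ≥0∞ := fun x => limsup (fun n : ℕ => μ (E ∩ ball x ((1 / 2) ^ n)) /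
      μ (ball x ((1 / 2) ^ n))) atTop
  have hv : Measurable v := Measurable.limsup fun n =>
    (measurable_measure_inter_ball hE _).div
      (by simpa using measurable_measure_inter_ball (μ := μ) MeasurableSet.univ ((1 / 2) ^ n))
  have hvle : ∀ x, v x ≤ upperDens μ E x := fun x => by
    have htend : Tendsto (fun n : ℕ => ((1 : ℝ) / 2) ^ n) atTop (𝓝[>] 0) :=
      tendsto_pow_atTop_nhdsWithin_zero_of_lt_one (by norm_num) (by norm_num)
    exact (limsup_le_limsup_of_le (u := fun r : ℝ => μ (E ∩ ball x r) / μ (ball x r)) htend)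
  convert measurableSet_lt measurable_const hv using 1
  ext x
  rw [mem_ofPred_eq, mem_ofPred_eq]
  refine ⟨fun h => pos_iff_ne_zero.2 fun h0 => ?_, fun h => lt_of_lt_of_le h (hvle x)⟩
  refine (h.trans_le (upperDens_le_dyadic hD E x)).ne' ?_
  rw [mul_eq_zero]
  exact Or.inr h0

theorem measurableSet_essBdry [BorelSpace X] [SecondCountableTopology X] [SFinite μ]
    {CD : ℝ≥0} (hD : Doubling μ CD) {E : Set X} (hE : MeasurableSet E) :
    MeasurableSet (essBdry μ E) :=
  (measurableSet_upperDens_pos hD hE).inter (measurableSet_upperDens_pos hD hE.compl)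

end EssentialBoundary

section Additivity

variable {X : Type*} [MetricSpace X] [MeasurableSpace X] {μ : Measure X}

theorem measurable_codimH_superlevel (h : codimH μ ∅ = 0) (S : Set X) (f : X → ℝ≥0∞) :
    Measurable fun t : ℝ => codimH μ {x ∈ S | ENNReal.ofReal t < f x} := by
  refine Antitone.measurable fun s t hst => codimH_mono h ?_
  exact fun x hx => ⟨hx.1, (ENNReal.ofReal_le_ofReal hst).trans_lt hx.2⟩

theorem outerLint_mono_set (h : codimH μ ∅ = 0) {S T : Set X} (hST : S ⊆ T) (f : X → ℝ≥0∞) :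
    outerLint (codimH μ) S f ≤ outerLint (codimH μ) T f :=
  lintegral_mono fun _ => codimH_mono h fun _ hx => ⟨hST hx.1, hx.2⟩

theorem outerLint_inter_add_diff [BorelSpace X] (h : codimH μ ∅ = 0) {A : Set X}
    (hA : MeasurableSet A) (S : Set X) (f : X → ℝ≥0∞) :
    outerLint (codimH μ) (S ∩ A) f + outerLint (codimH μ) (S \ A) f =
      outerLint (codimH μ) S f := by
  rw [outerLint, outerLint, outerLint, ← lintegral_add_left (measurable_codimH_superlevel h _ _)]
  refine lintegral_congr fun t => ?_
  rw [← codimH_inter_add_diff h hA {x ∈ S | ENNReal.ofReal t < f x}]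
  congr 2 <;> ext x <;> simp only [mem_ofPred_eq, mem_inter_iff, Set.mem_sdiff] <;> tauto

theorem outerLint_union_le (h : codimH μ ∅ = 0) (S T : Set X) (f : X → ℝ≥0∞) :
    outerLint (codimH μ) (S ∪ T) f ≤ outerLint (codimH μ) S f + outerLint (codimH μ) T f := by
  rw [outerLint, outerLint, outerLint, ← lintegral_add_left (measurable_codimH_superlevel h _ _)]
  refine lintegral_mono fun t => (codimH_mono h ?_).trans (codimH_union_le h _ _)
  rintro x ⟨hx | hx, hxt⟩
  exacts [Or.inl ⟨hx, hxt⟩, Or.inr ⟨hx, hxt⟩]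

theorem outerLint_le_of_ae_eq (h : codimH μ ∅ = 0) {S : Set X} {f g : X → ℝ≥0∞}
    (hfg : codimH μ {x ∈ S | f x ≠ g x} = 0) :
    outerLint (codimH μ) S f ≤ outerLint (codimH μ) S g := by
  refine lintegral_mono fun t => codimH_le_of_subset_union_null h hfg ?_
  rintro x ⟨hx, hxt⟩
  by_cases hne : f x = g x
  · exact Or.inl ⟨hx, hne ▸ hxt⟩
  · exact Or.inr ⟨hx, hne⟩

theorem outerLint_congr (h : codimH μ ∅ = 0) {S : Set X} {f g : X → ℝ≥0∞}
    (hfg : codimH μ {x ∈ S | f x ≠ g x} = 0) :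
    outerLint (codimH μ) S f = outerLint (codimH μ) S g :=
  le_antisymm (outerLint_le_of_ae_eq h hfg)
    (outerLint_le_of_ae_eq h (by simpa only [ne_comm] using hfg))

theorem outerLint_eq_zero (h : codimH μ ∅ = 0) {S : Set X} (hS : codimH μ S = 0)
    (f : X → ℝ≥0∞) : outerLint (codimH μ) S f = 0 := by
  refine le_antisymm ?_ zero_le
  calc outerLint (codimH μ) S f ≤ ∫⁻ _ in Ioi (0 : ℝ), 0 :=
        lintegral_mono fun t => (codimH_mono h fun x hx => hx.1).trans hS.le
    _ = 0 := lintegral_zero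

theorem codimH_eq_zero_of_outerLint_eq_zero (h : codimH μ ∅ = 0) {S : Set X} {f : X → ℝ≥0∞}
    {γ : ℝ≥0∞} (hγ : 0 < γ) (hf : ∀ x ∈ S, γ ≤ f x) (h0 : outerLint (codimH μ) S f = 0) :
    codimH μ S = 0 := by
  obtain ⟨q, hq0, hqγ⟩ := ENNReal.lt_iff_exists_nnreal_btwn.1 hγ
  by_contra hne
  have hle : ∫⁻ _ in Ioo (0 : ℝ) q, codimH μ S ≤ 0 := by
    rw [← h0]
    refine le_trans ?_ (lintegral_mono_set (Ioo_subset_Ioi_self (b := (0 : ℝ)) (a := (q : ℝ))))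
    refine setLIntegral_mono (measurable_codimH_superlevel h _ _) fun t ht =>
      codimH_mono h fun x hx => ⟨hx, ?_⟩
    refine lt_of_le_of_lt ?_ (hqγ.trans_le (hf x hx))
    rw [← ENNReal.ofReal_coe_nnreal]
    exact ENNReal.ofReal_le_ofReal ht.2.le
  rw [setLIntegral_const, Real.volume_Ioo, sub_zero, ENNReal.ofReal_coe_nnreal] at hle
  rcases mul_eq_zero.1 (le_zero_iff.1 hle) with h1 | h1
  exacts [hne h1, hq0.ne' h1]

theorem PerimRepr.perim_univ {θ : Set X → X → ℝ≥0∞} (hθ : PerimRepr μ θ) {E : Set X}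
    (hE : FinPerim μ E) : perim μ E univ = outerLint (codimH μ) (essBdry μ E) (θ E) := by
  obtain ⟨γ, C, -, -, hθ⟩ := hθ
  simpa using (hθ E hE).2 univ MeasurableSet.univ

variable [BorelSpace X] [SecondCountableTopology X] [SFinite μ] {CD : ℝ≥0}
  {θ : Set X → X → ℝ≥0∞}

/-- In an isotropic space, the perimeter of a disjoint union splits over the two pieces of the
essential boundary that meet the essential boundary of the union. -/
theorem perim_union_eq (hD : Doubling μ CD) (hθ : PerimRepr μ θ)
    (hiso : ∀ E F : Set X, FinPerim μ E → FinPerim μ F → F ⊆ E →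
      codimH μ {x ∈ essBdry μ F ∩ essBdry μ E | θ F x ≠ θ E x} = 0)
    {F G : Set X} (hF : FinPerim μ F) (hG : FinPerim μ G) (hFG : FinPerim μ (F ∪ G))
    (hdisj : Disjoint F G) :
    perim μ (F ∪ G) univ =
      outerLint (codimH μ) (essBdry μ F ∩ essBdry μ (F ∪ G)) (θ F) +
      outerLint (codimH μ) (essBdry μ G \ essBdry μ F) (θ G) := by
  have h := hθ.codimH_empty
  have hnull : codimH μ {x ∈ essBdry μ G \ essBdry μ F | θ G x ≠ θ (F ∪ G) x} = 0 := by
    refine le_antisymm ((codimH_mono h ?_).trans (hiso _ _ hFG hG subset_union_right).le) zero_le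
    rintro x ⟨hx, hne⟩
    exact ⟨⟨hx.1, union_comm G F ▸ essBdry_diff_subset hdisj.symm hx⟩, hne⟩
  have hdiff : essBdry μ (F ∪ G) \ essBdry μ F = essBdry μ G \ essBdry μ F := by
    refine Subset.antisymm (fun x hx => ⟨?_, hx.2⟩) fun x hx => ⟨?_, hx.2⟩
    · exact (essBdry_union_subset F G hx.1).resolve_left hx.2
    · exact union_comm G F ▸ essBdry_diff_subset hdisj.symm hx
  rw [hθ.perim_univ hFG, ← outerLint_inter_add_diff h (measurableSet_essBdry hD hF.1), hdiff,
    outerLint_congr h (hiso _ _ hFG hF subset_union_left), outerLint_congr h hnull, inter_comm]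

theorem perim_union_eq_add_iff (hD : Doubling μ CD) (hθ : PerimRepr μ θ)
    (hiso : ∀ E F : Set X, FinPerim μ E → FinPerim μ F → F ⊆ E →
      codimH μ {x ∈ essBdry μ F ∩ essBdry μ E | θ F x ≠ θ E x} = 0)
    {F G : Set X} (hF : FinPerim μ F) (hG : FinPerim μ G) (hFG : FinPerim μ (F ∪ G))
    (hdisj : Disjoint F G) :
    perim μ (F ∪ G) univ = perim μ F univ + perim μ G univ ↔
      codimH μ (essBdry μ F ∩ essBdry μ G) = 0 := by
  have h := hθ.codimH_empty
  have hsplitG := outerLint_inter_add_diff h (measurableSet_essBdry hD hF.1)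
    (essBdry μ G) (θ G)
  rw [← hθ.perim_univ hG, inter_comm] at hsplitG
  rw [perim_union_eq hD hθ hiso hF hG hFG hdisj]
  constructor
  · intro heq
    have hfin : perim μ F univ + outerLint (codimH μ) (essBdry μ G \ essBdry μ F) (θ G) ≠ ⊤ :=
      ENNReal.add_ne_top.2 ⟨hF.2.ne, ne_top_of_le_ne_top hG.2.ne (hsplitG ▸ le_add_self)⟩
    have hle : perim μ F univ + outerLint (codimH μ) (essBdry μ G \ essBdry μ F) (θ G) +
        outerLint (codimH μ) (essBdry μ F ∩ essBdry μ G) (θ G) ≤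
        perim μ F univ + outerLint (codimH μ) (essBdry μ G \ essBdry μ F) (θ G) + 0 := by
      rw [add_zero, add_assoc, add_comm (outerLint _ (_ \ _) _), hsplitG, ← heq,
        hθ.perim_univ hF]
      gcongr
      exact outerLint_mono_set h inter_subset_left _
    have hzero := le_zero_iff.1 ((ENNReal.add_le_add_iff_left hfin).1 hle)
    obtain ⟨γ, C, hγ, -, hbound⟩ := hθ
    exact codimH_eq_zero_of_outerLint_eq_zero h hγ
      (fun x hx => ((hbound G hG).1 x hx.2).1) hzero
  · intro hnull
    rw [outerLint_eq_zero h hnull, zero_add] at hsplitG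
    rw [hsplitG]
    congr 1
    rw [hθ.perim_univ hF]
    refine le_antisymm (outerLint_mono_set h inter_subset_left _) ?_
    have hcover : essBdry μ F ⊆
        essBdry μ F ∩ essBdry μ (F ∪ G) ∪ essBdry μ F ∩ essBdry μ G := fun x hx => by
      by_cases hxG : x ∈ essBdry μ G
      · exact Or.inr ⟨hx, hxG⟩
      · exact Or.inl ⟨hx, essBdry_diff_subset hdisj ⟨hx, hxG⟩⟩
    refine (outerLint_mono_set h hcover _).trans ((outerLint_union_le h _ _ _).trans ?_)
    rw [outerLint_eq_zero h hnull, add_zero]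

end Additivity

variable {X : Type*} [MetricSpace X] [CompleteSpace X] [TopologicalSpace.SeparableSpace X]
  [MeasurableSpace X] [BorelSpace X]

/-- Stability of indecomposability under increasing unions. -/
theorem indecomposable_of_increasing_union
    (μ : Measure X) [IsLocallyFiniteMeasure μ] (hμ : μ ≠ 0)
    (hPI : IsPI μ) (hIso : Isotropic μ)
    (E : Set X) (hE : FinPerim μ E)
    (En : ℕ → Set X) (hmono : Monotone En)
    (hind : ∀ n, Indecomposable μ (En n)) (hunion : (⋃ n, En n) = E) :
    Indecomposable μ E := by
  obtain ⟨CD, -, -, hD, -⟩ := hPI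
  obtain ⟨θ, hθ, hiso⟩ := hIso
  have : SecondCountableTopology X := UniformSpace.secondCountable_of_separable X
  refine ⟨hE, ?_⟩
  rintro ⟨F, G, hF, hG, hdisj, hFG, hFpos, hGpos, hadd⟩
  rw [inter_univ] at hFG
  have hnull : codimH μ (essBdry μ F ∩ essBdry μ G) = 0 :=
    (perim_union_eq_add_iff hD hθ hiso hF hG (hFG ▸ hE) hdisj).1 (hFG ▸ hadd)
  have hpos : ∀ A ⊆ E, 0 < μ A → ∃ n, 0 < μ (A ∩ En n) := fun A hA hApos => by
    by_contra! hcon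
    refine hApos.ne' ?_
    rw [← inter_eq_left.2 hA, ← hunion, inter_iUnion]
    exact measure_iUnion_null fun n => le_zero_iff.1 (hcon n)
  obtain ⟨i, hi⟩ := hpos F (hFG ▸ subset_union_left) hFpos
  obtain ⟨j, hj⟩ := hpos G (hFG ▸ subset_union_right) hGpos
  set n := max i j
  have hEn : F ∩ En n ∪ G ∩ En n = En n := by
    rw [← union_inter_distrib_right, hFG, inter_eq_right, ← hunion]
    exact subset_iUnion En n
  have hFn := hF.inter (hind n).1
  have hGn := hG.inter (hind n).1
  have hdisjn : Disjoint (F ∩ En n) (G ∩ En n) :=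
    hdisj.mono inter_subset_left inter_subset_left
  have hsub : essBdry μ (F ∩ En n) ∩ essBdry μ (G ∩ En n) ⊆ essBdry μ F ∩ essBdry μ G := by
    rintro x ⟨⟨hxF, -⟩, ⟨hxG, -⟩⟩
    have hxF' := hxF.trans_le (upperDens_mono inter_subset_left x)
    have hxG' := hxG.trans_le (upperDens_mono inter_subset_left x)
    exact ⟨mem_essBdry_of_disjoint hdisj hxF' hxG', mem_essBdry_of_disjoint hdisj.symm hxG' hxF'⟩
  have hnulln : codimH μ (essBdry μ (F ∩ En n) ∩ essBdry μ (G ∩ En n)) = 0 :=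
    le_zero_iff.1 ((codimH_mono hθ.codimH_empty hsub).trans hnull.le)
  have haddn := (perim_union_eq_add_iff hD hθ hiso hFn hGn (by rw [hEn]; exact (hind n).1)
    hdisjn).2 hnulln
  rw [hEn] at haddn
  refine (hind n).2 ⟨F ∩ En n, G ∩ En n, hFn, hGn, hdisjn, by rw [hEn, inter_univ], ?_, ?_, haddn⟩
  · exact hi.trans_le (measure_mono (inter_subset_inter_right _ (hmono (le_max_left i j))))
  · exact hj.trans_le (measure_mono (inter_subset_inter_right _ (hmono (le_max_right i j))))

end PaperBV
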